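/- For every integer r ≥ 1 and every choice of indices i(n) with 1 ≤ i(n) ≤ n for each n, the binomial moments of the centralized major index over permutations ending in i(n) satisfy lim_{n→∞} B_{2r}(n, i(n)) · r! · 2^r · 36^r / n^{3r} = 1 and lim_{n→∞} B_{2r+1}(n, i(n)) · (r−1)! · 2^r · 36^r / n^{3r} = −1; that is, B_{2r}(n,i) = (1/(2^r r!)) (n³/36)^r plus lower order terms in n, and B_{2r+1}(n,i) = −(r/(2^r r!)) (n³/36)^r plus lower order terms in n, uniformly in i. -/

import Mathlib

open Finset Filter

/-- The major index of a permutation of `Fin n` (positions taken 1-based): the sum of the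
(1-based) positions `i` with `π(i) > π(i+1)`. -/
def majIdx {n : ℕ} (π : Equiv.Perm (Fin n)) : ℕ :=
  ∑ p ∈ (univ : Finset (Fin n × Fin n)).filter
      (fun p => p.2.val = p.1.val + 1 ∧ π p.2 < π p.1), (p.1.val + 1)

/-- `B s n i` is the `s`-th binomial moment of the centralized major index over the `(n−1)!`
permutations of `{1,…,n}` whose last entry is `i`:
`B_s(n,i) = (1/(n−1)!) Σ_{π(n)=i} (1/s!) ∏_{j=0}^{s−1} (maj(π) − (n−i) − (n−1)(n−2)/4 − j)`. -/
noncomputable def majBinomMoment (s n i : ℕ) : ℝ :=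
  (1 / ((n - 1).factorial : ℝ)) *
    ∑ π ∈ (univ : Finset (Equiv.Perm (Fin n))).filter
        (fun π => ∀ h : n - 1 < n, (π ⟨n - 1, h⟩).val + 1 = i),
      (1 / (s.factorial : ℝ)) * ∏ j ∈ Finset.range s,
        ((majIdx π : ℝ) - ((n : ℝ) - (i : ℝ)) - ((n : ℝ) - 1) * ((n : ℝ) - 2) / 4 - (j : ℝ))

theorem majIdx_succ_eq_sum {n : ℕ} (π : Equiv.Perm (Fin (n + 1))) :
    majIdx π = ∑ p : Fin n, if π p.succ < π p.castSucc then p.val + 1 else 0 := by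
  rw [majIdx, ← Finset.sum_filter]
  symm
  refine Finset.sum_nbij (fun p => (p.castSucc, p.succ)) ?_ ?_ ?_ ?_
  · intro p hp
    simpa using hp
  · intro p _ q _ h
    simpa using h
  · rintro ⟨p, q⟩ h
    simp only [coe_filter, mem_univ, true_and, Set.mem_ofPred_eq] at h
    obtain ⟨h1, h2⟩ := h
    have hp : p.val < n := by omega
    have e1 : (⟨p.val, hp⟩ : Fin n).castSucc = p := rfl
    have e2 : (⟨p.val, hp⟩ : Fin n).succ = q := Fin.ext h1.symm
    refine ⟨⟨p.val, hp⟩, ?_, ?_⟩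
    · simpa [e1, e2] using h2
    · simp [e1, e2]
  · intro p _
    simp

/-- The permutation with last value `a` whose other values are order-isomorphic to `σ`. -/
def insertLast {n : ℕ} (a : Fin (n + 1)) (σ : Equiv.Perm (Fin n)) :
    Equiv.Perm (Fin (n + 1)) :=
  finSuccEquivLast.trans (σ.optionCongr.trans (finSuccEquiv' a).symm)

@[simp]
theorem insertLast_last {n : ℕ} (a : Fin (n + 1)) (σ : Equiv.Perm (Fin n)) :
    insertLast a σ (Fin.last n) = a := by
  simp [insertLast]

@[simp]
theorem insertLast_castSucc {n : ℕ} (a : Fin (n + 1)) (σ : Equiv.Perm (Fin n)) (p : Fin n) :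
    insertLast a σ p.castSucc = a.succAbove (σ p) := by
  simp [insertLast]

theorem insertLast_injective {n : ℕ} (a : Fin (n + 1)) :
    Function.Injective (insertLast a : Equiv.Perm (Fin n) → Equiv.Perm (Fin (n + 1))) := by
  intro σ τ h
  ext p
  have := congrArg (fun e => e p.castSucc) h
  simpa [Fin.val_inj] using this

theorem exists_insertLast_eq {n : ℕ} {a : Fin (n + 1)} {π : Equiv.Perm (Fin (n + 1))}
    (h : π (Fin.last n) = a) : ∃ σ, insertLast a σ = π := by
  set e : Option (Fin n) ≃ Option (Fin n) :=
    finSuccEquivLast.symm.trans (π.trans (finSuccEquiv' a)) with he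
  have hnone : e none = none := by simp [he, h]
  refine ⟨Equiv.removeNone e, ?_⟩
  have h2 : (Equiv.removeNone e).optionCongr = e := by
    ext1 x
    cases x with
    | none => simp [hnone]
    | some x =>
      have := Equiv.removeNone_some e (x := x)
      rw [Equiv.optionCongr_apply, Option.map_some]
      apply this
      rcases h3 : e (some x) with _ | y
      · exact absurd (e.injective (h3.trans hnone.symm)) (by simp)
      · exact ⟨y, rfl⟩
  rw [insertLast, h2]
  ext1 x
  simp [he]

theorem majIdx_insertLast {n : ℕ} (a : Fin (n + 2)) (σ : Equiv.Perm (Fin (n + 1))) :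
    majIdx (insertLast a σ) =
      majIdx σ + if a.val ≤ (σ (Fin.last n)).val then n + 1 else 0 := by
  rw [majIdx_succ_eq_sum, majIdx_succ_eq_sum, Fin.sum_univ_castSucc]
  congr 1
  · simp [← Fin.castSucc_succ]
  · simp [Fin.lt_succAbove_iff_le_castSucc, Fin.le_def]

theorem sum_filter_last_eq {n : ℕ} (a : Fin (n + 1)) (F : Equiv.Perm (Fin (n + 1)) → ℝ) :
    ∑ π with π (Fin.last n) = a, F π = ∑ σ, F (insertLast a σ) := by
  symm
  refine Finset.sum_nbij (insertLast a) (by simp) (insertLast_injective a).injOn ?_ (by simp)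
  intro π hπ
  obtain ⟨σ, rfl⟩ := exists_insertLast_eq (by simpa using hπ)
  exact ⟨σ, by simp⟩

/-- Expectation of `f (Y₁ + ⋯ + Yₙ)` for independent `Yₖ` uniformly distributed on the `k`
numbers `-(k-1)/2, -(k-1)/2 + 1, …, (k-1)/2`. -/
noncomputable def uniformSum : ℕ → ((ℝ → ℝ) →ₗ[ℝ] ℝ)
  | 0 => LinearMap.proj 0
  | n + 1 => (1 / ((n : ℝ) + 1)) •
      ∑ j ∈ range (n + 1), uniformSum n ∘ₗ LinearMap.funLeft ℝ ℝ (fun x => x + (j - n / 2 : ℝ))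

theorem uniformSum_zero (f : ℝ → ℝ) : uniformSum 0 f = f 0 := rfl

theorem uniformSum_succ (n : ℕ) (f : ℝ → ℝ) :
    uniformSum (n + 1) f = (1 / ((n : ℝ) + 1)) *
      ∑ j ∈ range (n + 1), uniformSum n (fun x => f (x + (j - n / 2 : ℝ))) := by
  simp [uniformSum, LinearMap.sum_apply, LinearMap.funLeft, Function.comp_def]

theorem sum_range_cyclic {n a : ℕ} (ha : a ≤ n + 1) (g : ℝ → ℝ) :
    ∑ b ∈ range (n + 1), g (n - b + if a ≤ b then (n : ℝ) + 1 else 0) =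
      ∑ j ∈ range (n + 1), g (j + (n + 1 - a)) := by
  refine Finset.sum_nbij' (fun b => if a ≤ b then n + a - b else a - b - 1)
    (fun j => if a ≤ j then n + a - j else a - j - 1) ?_ ?_ ?_ ?_ ?_
  · intro b hb; simp only [mem_range] at *; split_ifs <;> omega
  · intro b hb; simp only [mem_range] at *; split_ifs <;> omega
  · intro b hb; simp only [mem_range] at *; split_ifs <;> omega
  · intro b hb; simp only [mem_range] at *; split_ifs <;> omega
  · intro b hb
    simp only [mem_range] at hb
    congr 1
    split_ifs with h
    · rw [Nat.cast_sub (by omega)]; push_cast; ring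
    · rw [Nat.cast_sub (by omega), Nat.cast_sub (by omega)]; push_cast; ring

theorem sum_majIdx_last (n : ℕ) (a : Fin (n + 1)) (f : ℝ → ℝ) :
    ∑ π : Equiv.Perm (Fin (n + 1)) with π (Fin.last n) = a,
      f (majIdx π - (n - a.val) - n * (n - 1) / 4) = n.factorial * uniformSum n f := by
  induction n generalizing f with
  | zero =>
    obtain rfl : a = 0 := Fin.ext (by omega)
    rw [sum_filter_last_eq]
    simp [uniformSum_zero, majIdx_succ_eq_sum]
  | succ n ih =>
    rw [sum_filter_last_eq, ← Finset.sum_fiberwise univ (fun σ => σ (Fin.last n))]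
    set g : ℝ → ℝ := fun y => n.factorial * uniformSum n
      (fun x => f (x + y - (n + 1 - a.val) - n / 2)) with hg
    have key (b : Fin (n + 1)) :
        ∑ σ : Equiv.Perm (Fin (n + 1)) with σ (Fin.last n) = b,
          f (majIdx (insertLast a σ) - (((n + 1 : ℕ) : ℝ) - a.val)
            - ((n + 1 : ℕ) : ℝ) * (((n + 1 : ℕ) : ℝ) - 1) / 4) =
        g (n - b.val + if a.val ≤ b.val then (n : ℝ) + 1 else 0) := by
      rw [hg]
      simp only
      rw [← ih b]
      refine Finset.sum_congr rfl fun σ hσ => ?_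
      simp only [mem_filter, mem_univ, true_and] at hσ
      rw [majIdx_insertLast, hσ]
      congr 1
      split_ifs <;> push_cast <;> ring
    rw [Finset.sum_congr rfl fun b _ => key b,
      Fin.sum_univ_eq_sum_range
        (fun b => g (n - b + if a.val ≤ b then (n : ℝ) + 1 else 0)) (n + 1),
      sum_range_cyclic (by omega), hg, ← Finset.mul_sum, uniformSum_succ, Nat.factorial_succ]
    push_cast
    have hcancel (A S : ℝ) : ((n + 1 : ℝ) * A) * (1 / (n + 1) * S) = A * S := by field_simp
    rw [hcancel]
    congr 1
    refine Finset.sum_congr rfl fun j _ => ?_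
    congr 1
    ext x
    congr 1
    ring

/-- The `l`-th moment of the uniform distribution on `-n/2, -n/2 + 1, …, n/2`. -/
noncomputable def uniformMoment (n l : ℕ) : ℝ :=
  (1 / ((n : ℝ) + 1)) * ∑ j ∈ range (n + 1), ((j : ℝ) - n / 2) ^ l

theorem uniformMoment_zero (n : ℕ) : uniformMoment n 0 = 1 := by
  have : (n : ℝ) + 1 ≠ 0 := by positivity
  simp [uniformMoment, this]

theorem uniformMoment_two (n : ℕ) : uniformMoment n 2 = n * (n + 2) / 12 := by
  have h (m : ℕ) (c : ℝ) : ∑ j ∈ range m, ((j : ℝ) - c) ^ 2 =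
      m * (m - 1) * (2 * m - 1) / 6 - c * (m * (m - 1)) + m * c ^ 2 := by
    induction m with
    | zero => simp
    | succ m ih => rw [sum_range_succ, ih]; push_cast; ring
  rw [uniformMoment, h]
  push_cast
  field_simp
  ring

theorem uniformMoment_odd (n : ℕ) {l : ℕ} (hl : Odd l) : uniformMoment n l = 0 := by
  have h : ∑ j ∈ range (n + 1), ((j : ℝ) - n / 2) ^ l =
      -∑ j ∈ range (n + 1), ((j : ℝ) - n / 2) ^ l := by
    conv_lhs => rw [← Finset.sum_range_reflect]
    rw [← Finset.sum_neg_distrib]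
    refine Finset.sum_congr rfl fun j hj => ?_
    rw [mem_range] at hj
    rw [← hl.neg_pow, Nat.add_sub_cancel, Nat.cast_sub (by omega)]
    congr 1
    ring
  rw [uniformMoment, show ∑ j ∈ range (n + 1), ((j : ℝ) - n / 2) ^ l = 0 by linarith, mul_zero]

theorem abs_uniformMoment_le (n l : ℕ) : |uniformMoment n l| ≤ ((n : ℝ) + 1) ^ l := by
  have hn : (0 : ℝ) < (n : ℝ) + 1 := by positivity
  rw [uniformMoment, abs_mul, abs_of_pos (by positivity), one_div, inv_mul_le_iff₀ hn]
  calc |∑ j ∈ range (n + 1), ((j : ℝ) - n / 2) ^ l|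
      ≤ ∑ j ∈ range (n + 1), |((j : ℝ) - n / 2) ^ l| := Finset.abs_sum_le_sum_abs _ _
    _ ≤ ∑ j ∈ range (n + 1), ((n : ℝ) + 1) ^ l := by
        refine Finset.sum_le_sum fun j hj => ?_
        rw [abs_pow]
        have hj' : (j : ℝ) ≤ n := by
          exact_mod_cast Nat.lt_succ_iff.mp (mem_range.mp hj)
        gcongr
        rw [abs_le]
        constructor <;> linarith [(j.cast_nonneg : (0 : ℝ) ≤ j), (n.cast_nonneg : (0 : ℝ) ≤ n)]
    _ = ((n : ℝ) + 1) * ((n : ℝ) + 1) ^ l := by simp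

theorem uniformSum_succ_pow (n s : ℕ) :
    uniformSum (n + 1) (fun x => x ^ s) =
      ∑ k ∈ range (s + 1), s.choose k * uniformMoment n (s - k) *
        uniformSum n (fun x => x ^ k) := by
  have h (c : ℝ) : uniformSum n (fun x => (x + c) ^ s) =
      ∑ k ∈ range (s + 1), (c ^ (s - k) * s.choose k) * uniformSum n (fun x => x ^ k) := by
    have : (fun x : ℝ => (x + c) ^ s) =
        ∑ k ∈ range (s + 1), (c ^ (s - k) * s.choose k) • (fun x : ℝ => x ^ k) := by
      ext x
      simp only [add_pow, Finset.sum_apply, Pi.smul_apply, smul_eq_mul]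
      exact Finset.sum_congr rfl fun k _ => by ring
    simp [this]
  simp only [uniformSum_succ, h, uniformMoment]
  rw [Finset.sum_comm, Finset.mul_sum]
  refine Finset.sum_congr rfl fun k _ => ?_
  rw [← Finset.sum_mul, ← Finset.sum_mul]
  ring

theorem uniformSum_pow_odd (n : ℕ) {s : ℕ} (hs : Odd s) : uniformSum n (fun x => x ^ s) = 0 := by
  induction n generalizing s with
  | zero => simp [uniformSum_zero, hs.pos.ne']
  | succ n ih =>
    rw [uniformSum_succ_pow]
    refine Finset.sum_eq_zero fun k hk => ?_
    rcases Nat.even_or_odd k with h | h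
    · rw [uniformMoment_odd n (Nat.Odd.sub_even (by simpa [Nat.lt_succ_iff] using hk) hs h)]
      simp
    · rw [ih h, mul_zero]

theorem tendsto_succ_pow_sub_pow_div (p : ℕ) :
    Tendsto (fun n : ℕ => (((n : ℝ) + 2) ^ (p + 1) - ((n : ℝ) + 1) ^ (p + 1)) / ((n : ℝ) + 1) ^ p)
      atTop (nhds (p + 1)) := by
  have h : HasDerivAt (fun x : ℝ => x ^ (p + 1)) ((p : ℝ) + 1) 1 := by
    simpa using hasDerivAt_pow (p + 1) (1 : ℝ)
  have hu : Tendsto (fun n : ℕ => 1 / ((n : ℝ) + 1)) atTop (nhdsWithin 0 {0}ᶜ) :=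
    tendsto_nhdsWithin_iff.mpr ⟨tendsto_one_div_add_atTop_nhds_zero_nat, .of_forall fun n => by
      simpa using (by positivity : (n : ℝ) + 1 ≠ 0)⟩
  refine (h.tendsto_slope_zero.comp hu).congr fun n => ?_
  have hn : (n : ℝ) + 1 ≠ 0 := by positivity
  have h2 : 1 + 1 / ((n : ℝ) + 1) = (n + 2) / (n + 1) := by field_simp; ring
  simp only [Function.comp_apply, smul_eq_mul, h2, div_pow]
  field_simp
  simp [pow_succ]
  field_simp

/-- A Stolz–Cesàro theorem for comparison with powers of `n + 1`. -/
theorem tendsto_div_pow_succ_of_sub {g : ℕ → ℝ} {p : ℕ} {c : ℝ}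
    (h : Tendsto (fun n => (g (n + 1) - g n) / ((n : ℝ) + 1) ^ p) atTop (nhds c)) :
    Tendsto (fun n => g n / ((n : ℝ) + 1) ^ (p + 1)) atTop (nhds (c / (p + 1))) := by
  have hp : (p : ℝ) + 1 ≠ 0 := by positivity
  set e : ℕ → ℝ := fun n => g n - c / (p + 1) * ((n : ℝ) + 1) ^ (p + 1) with he
  have hdiff : (fun n => e (n + 1) - e n) =o[atTop] fun n : ℕ => ((n : ℝ) + 1) ^ p := by
    rw [Asymptotics.isLittleO_iff_tendsto' (.of_forall fun n hn => absurd hn (by positivity))]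
    have := h.sub ((tendsto_succ_pow_sub_pow_div p).const_mul (c / (p + 1)))
    rw [div_mul_cancel₀ _ hp, sub_self] at this
    refine this.congr fun n => ?_
    simp only [he]
    push_cast
    ring
  have hge (n : ℕ) : (n : ℝ) ≤ ∑ k ∈ range n, ((k : ℝ) + 1) ^ p := by
    calc (n : ℝ) = ∑ k ∈ range n, (1 : ℝ) := by simp
      _ ≤ _ := Finset.sum_le_sum fun k _ => one_le_pow₀ (by simp)
  have hsum := hdiff.sum_range (fun n => by positivity)
    (tendsto_atTop_mono hge tendsto_natCast_atTop_atTop)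
  simp only [Finset.sum_range_sub] at hsum
  have hle : (fun n : ℕ => ∑ k ∈ range n, ((k : ℝ) + 1) ^ p) =O[atTop]
      fun n : ℕ => ((n : ℝ) + 1) ^ (p + 1) := by
    refine Asymptotics.IsBigO.of_bound 1 (.of_forall fun n => ?_)
    rw [Real.norm_of_nonneg (by positivity), Real.norm_of_nonneg (by positivity), one_mul]
    calc ∑ k ∈ range n, ((k : ℝ) + 1) ^ p ≤ ∑ k ∈ range n, ((n : ℝ) + 1) ^ p := by
          refine Finset.sum_le_sum fun k hk => ?_
          have : (k : ℝ) ≤ n := by exact_mod_cast (mem_range.mp hk).le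
          gcongr
      _ = n * ((n : ℝ) + 1) ^ p := by simp
      _ ≤ ((n : ℝ) + 1) ^ (p + 1) := by
          rw [pow_succ']
          gcongr
          linarith
  have h1 := (hsum.trans_isBigO hle).tendsto_div_nhds_zero
  have h2 : Tendsto (fun n : ℕ => e 0 * (1 / ((n : ℝ) + 1)) ^ (p + 1)) atTop (nhds 0) := by
    simpa using ((tendsto_one_div_add_atTop_nhds_zero_nat (𝕜 := ℝ)).pow (p + 1)).const_mul (e 0)
  have h3 := (h1.add h2).add_const (c / ((p : ℝ) + 1))
  rw [add_zero, zero_add] at h3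
  refine h3.congr fun n => ?_
  have hn : (n : ℝ) + 1 ≠ 0 := by positivity
  simp only [he, div_pow, one_pow]
  field_simp
  ring

theorem tendsto_div_pow_of_lt {g : ℕ → ℝ} {a b : ℕ} {c : ℝ} (hab : a < b)
    (h : Tendsto (fun n => g n / ((n : ℝ) + 1) ^ a) atTop (nhds c)) :
    Tendsto (fun n => g n / ((n : ℝ) + 1) ^ b) atTop (nhds 0) := by
  obtain ⟨d, rfl⟩ := Nat.exists_eq_add_of_lt hab
  have := h.mul ((tendsto_one_div_add_atTop_nhds_zero_nat (𝕜 := ℝ)).pow (d + 1))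
  rw [zero_pow (by omega), mul_zero] at this
  refine this.congr fun n => ?_
  rw [one_div, inv_pow, add_assoc, pow_add _ a, ← div_eq_mul_inv, div_div]

/-- The limit of the `2r`-th moment of `uniformSum n` divided by `n ^ (3r)`. -/
noncomputable def momentLimit (r : ℕ) : ℝ := (2 * r).factorial / (r.factorial * 72 ^ r)

theorem momentLimit_succ (r : ℕ) :
    (2 * r + 2).choose (2 * r) * (1 / 12 * momentLimit r) / ((3 * r + 2 : ℕ) + 1) =
      momentLimit (r + 1) := by
  have h : ((2 * r + 2).choose (2 * r) : ℝ) = (2 * r + 2) * (2 * r + 1) / 2 := by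
    rw [Nat.choose_symm_add, Nat.cast_choose_two]
    push_cast
    ring
  rw [h, momentLimit, momentLimit, show 2 * (r + 1) = 2 * r + 1 + 1 by ring,
    Nat.factorial_succ (2 * r + 1), Nat.factorial_succ (2 * r), Nat.factorial_succ r]
  push_cast
  field_simp
  ring

theorem tendsto_uniformMoment_two_div :
    Tendsto (fun n : ℕ => uniformMoment n 2 / ((n : ℝ) + 1) ^ 2) atTop (nhds (1 / 12)) := by
  have := (((tendsto_one_div_add_atTop_nhds_zero_nat (𝕜 := ℝ)).pow 2).const_sub 1).div_const 12
  rw [zero_pow two_ne_zero, sub_zero] at this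
  refine this.congr fun n => ?_
  have hn : (n : ℝ) + 1 ≠ 0 := by positivity
  rw [uniformMoment_two]
  field_simp
  ring

theorem tendsto_uniformSum_pow_even_div (r : ℕ) :
    Tendsto (fun n : ℕ => uniformSum n (fun x => x ^ (2 * r)) / ((n : ℝ) + 1) ^ (3 * r))
      atTop (nhds (momentLimit r)) := by
  induction r using Nat.strong_induction_on with
  | _ r ih =>
  rcases r with _ | r
  · have h (n : ℕ) : uniformSum n (fun x => x ^ (2 * 0)) = 1 := by
      induction n with
      | zero => simp [uniformSum_zero]
      | succ n ih => rw [uniformSum_succ_pow]; simpa [uniformMoment_zero] using ih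
    simp only [h]
    simp [momentLimit]
  rw [← momentLimit_succ, show 3 * (r + 1) = 3 * r + 2 + 1 by ring]
  apply tendsto_div_pow_succ_of_sub
  have hterm (k : ℕ) (hk : k ∈ range (2 * r + 2)) :
      Tendsto (fun n : ℕ => ((2 * r + 2).choose k * uniformMoment n (2 * r + 2 - k) *
        uniformSum n (fun x => x ^ k)) / ((n : ℝ) + 1) ^ (3 * r + 2)) atTop
        (nhds (if k = 2 * r then (2 * r + 2).choose k * (1 / 12 * momentLimit r) else 0)) := by
    rw [mem_range] at hk
    rcases Nat.even_or_odd' k with ⟨t, rfl | rfl⟩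
    · rcases (by omega : t = r ∨ t < r) with rfl | ht
      · rw [if_pos rfl]
        refine ((tendsto_uniformMoment_two_div.mul (ih t (by omega))).const_mul _).congr
          fun n => ?_
        rw [Nat.add_sub_cancel_left, div_mul_div_comm, ← pow_add, add_comm 2]
        ring
      · rw [if_neg (by omega)]
        have h0 := tendsto_div_pow_of_lt (show 3 * t < 2 * t + r by omega) (ih t (by omega))
        have h1 : Tendsto (fun n : ℕ => uniformMoment n (2 * r + 2 - 2 * t) /
            ((n : ℝ) + 1) ^ (2 * r + 2 - 2 * t) *
            (uniformSum n (fun x => x ^ (2 * t)) / ((n : ℝ) + 1) ^ (2 * t + r)))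
            atTop (nhds 0) := by
          refine bdd_le_mul_tendsto_zero' 1 (.of_forall fun n => ?_) h0
          rw [abs_div, abs_of_pos (by positivity : (0 : ℝ) < ((n : ℝ) + 1) ^ _)]
          exact div_le_one_of_le₀ (abs_uniformMoment_le _ _) (by positivity)
        have h2 := h1.const_mul ((2 * r + 2).choose (2 * t) : ℝ)
        rw [mul_zero] at h2
        refine h2.congr fun n => ?_
        rw [div_mul_div_comm, ← pow_add,
          show 2 * r + 2 - 2 * t + (2 * t + r) = 3 * r + 2 by omega]
        ring
    · rw [if_neg (by omega)]
      simp only [uniformSum_pow_odd _ (odd_two_mul_add_one t)]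
      simp
  have hsum := tendsto_finsetSum _ hterm
  rw [Finset.sum_ite_eq' (range (2 * r + 2)) (2 * r), if_pos (by simp)] at hsum
  refine hsum.congr fun n => ?_
  rw [← Finset.sum_div, show 2 * (r + 1) = 2 * r + 2 by ring, uniformSum_succ_pow,
    Finset.sum_range_succ _ (2 * r + 2)]
  simp [uniformMoment_zero]

theorem tendsto_uniformSum_pow_div {k r : ℕ} (hk : k ≤ 2 * r + 1) :
    Tendsto (fun n : ℕ => uniformSum n (fun x => x ^ k) / ((n : ℝ) + 1) ^ (3 * r))
      atTop (nhds (if k = 2 * r then momentLimit r else 0)) := by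
  rcases Nat.even_or_odd' k with ⟨t, rfl | rfl⟩
  · rcases (by omega : t = r ∨ t < r) with rfl | ht
    · simpa using tendsto_uniformSum_pow_even_div t
    · rw [if_neg (by omega)]
      exact tendsto_div_pow_of_lt (by omega) (tendsto_uniformSum_pow_even_div t)
  · rw [if_neg (by omega)]
    simp only [uniformSum_pow_odd _ (odd_two_mul_add_one t)]
    simp

theorem majBinomMoment_succ_eq (s n : ℕ) {i : ℕ} (hi : 1 ≤ i ∧ i ≤ n + 1) :
    majBinomMoment s (n + 1) i = (∑ k ∈ range (s + 1), (descPochhammer ℝ s).coeff k *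
      uniformSum n (fun x => x ^ k)) / s.factorial := by
  obtain ⟨a, rfl⟩ := Nat.exists_eq_add_of_le' hi.1
  have ha : a < n + 1 := by omega
  have hpoly : (fun x : ℝ => (1 / (s.factorial : ℝ)) * ∏ j ∈ range s, (x - j)) =
      (1 / (s.factorial : ℝ)) • ∑ k ∈ range (s + 1),
        (descPochhammer ℝ s).coeff k • (fun x : ℝ => x ^ k) := by
    ext x
    rw [← descPochhammer_eval_eq_prod_range, Polynomial.eval_eq_sum_range,
      descPochhammer_natDegree]
    simp
  have hsum := sum_majIdx_last n ⟨a, ha⟩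
    (fun x : ℝ => (1 / (s.factorial : ℝ)) * ∏ j ∈ range s, (x - j))
  have hfilter : (univ.filter fun π : Equiv.Perm (Fin (n + 1)) =>
      ∀ h : n + 1 - 1 < n + 1, (π ⟨n + 1 - 1, h⟩).val + 1 = a + 1) =
      univ.filter fun π => π (Fin.last n) = ⟨a, ha⟩ := by
    ext π
    simp [Fin.ext_iff, Fin.last]
  rw [majBinomMoment, hfilter, Nat.add_sub_cancel]
  have hshift (m : ℝ) : m - (((n + 1 : ℕ) : ℝ) - ((a + 1 : ℕ) : ℝ)) -
      (((n + 1 : ℕ) : ℝ) - 1) * (((n + 1 : ℕ) : ℝ) - 2) / 4 = m - (n - a) - n * (n - 1) / 4 := by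
    push_cast
    ring
  simp only [hshift]
  rw [hsum, hpoly, map_smul, map_sum]
  simp only [map_smul, smul_eq_mul]
  have : (n.factorial : ℝ) ≠ 0 := by positivity
  field_simp

theorem tendsto_majBinomMoment_div {s r : ℕ} (hs : 2 * r ≤ s) (hs' : s ≤ 2 * r + 1) {i : ℕ → ℕ}
    (hi : ∀ n : ℕ, 1 ≤ n → 1 ≤ i n ∧ i n ≤ n) :
    Tendsto (fun n : ℕ => majBinomMoment s n (i n) / (n : ℝ) ^ (3 * r)) atTop
      (nhds ((descPochhammer ℝ s).coeff (2 * r) * momentLimit r / s.factorial)) := by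
  rw [← tendsto_add_atTop_iff_nat 1]
  have h := (tendsto_finsetSum (range (s + 1)) fun k hk =>
    (tendsto_uniformSum_pow_div (k := k) (r := r)
      (by rw [mem_range] at hk; omega)).const_mul ((descPochhammer ℝ s).coeff k)).div_const
        (s.factorial : ℝ)
  simp only [mul_ite, mul_zero] at h
  rw [Finset.sum_ite_eq' (range (s + 1)) (2 * r), if_pos (by rw [mem_range]; omega)] at h
  refine h.congr fun n => ?_
  rw [majBinomMoment_succ_eq s n (hi (n + 1) (by omega)), div_right_comm,
    Nat.cast_add_one]
  simp only [← mul_div_assoc, ← Finset.sum_div]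

theorem descPochhammer_coeff_self (s : ℕ) : (descPochhammer ℝ s).coeff s = 1 := by
  simpa [Polynomial.Monic, Polynomial.leadingCoeff, descPochhammer_natDegree] using
    monic_descPochhammer ℝ s

theorem descPochhammer_coeff_pred (s : ℕ) :
    (descPochhammer ℝ (s + 1)).coeff s = -((s + 1) * s / 2) := by
  induction s with
  | zero => simp
  | succ s ih =>
    rw [descPochhammer_succ_right, ← Polynomial.C_eq_natCast, mul_sub, Polynomial.coeff_sub,
      Polynomial.coeff_mul_X, Polynomial.coeff_mul_C, ih, descPochhammer_coeff_self]
    push_cast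
    ring

/-- For `r ≥ 1` and any choice of indices `i(n)` with `1 ≤ i(n) ≤ n`,
`lim_{n→∞} B_{2r}(n, i(n)) · r! · 2^r · 36^r / n^{3r} = 1` and
`lim_{n→∞} B_{2r+1}(n, i(n)) · (r−1)! · 2^r · 36^r / n^{3r} = −1`; i.e.
`B_{2r}(n,i) = (1/(2^r r!)) (n³/36)^r + l.o.t.` and
`B_{2r+1}(n,i) = −(r/(2^r r!)) (n³/36)^r + l.o.t.`, uniformly in `i`. -/
theorem majBinomMoment_leading (r : ℕ) (hr : 1 ≤ r) (i : ℕ → ℕ)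
    (hi : ∀ n : ℕ, 1 ≤ n → 1 ≤ i n ∧ i n ≤ n) :
    Tendsto (fun n : ℕ =>
        majBinomMoment (2 * r) n (i n) * (r.factorial : ℝ) * 2 ^ r * 36 ^ r / (n : ℝ) ^ (3 * r))
      atTop (nhds 1) ∧
    Tendsto (fun n : ℕ =>
        majBinomMoment (2 * r + 1) n (i n) * ((r - 1).factorial : ℝ) * 2 ^ r * 36 ^ r /
          (n : ℝ) ^ (3 * r))
      atTop (nhds (-1)) := by
  have hrfac : (r.factorial : ℝ) = r * (r - 1).factorial := by
    exact_mod_cast (Nat.mul_factorial_pred (by omega)).symm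
  have hr0 : (r : ℝ) ≠ 0 := by positivity
  have h72 : (72 : ℝ) ^ r = 2 ^ r * 36 ^ r := by rw [← mul_pow]; norm_num
  constructor
  · have h := (tendsto_majBinomMoment_div le_rfl (Nat.le_succ (2 * r)) hi).mul_const
      ((r.factorial : ℝ) * 2 ^ r * 36 ^ r)
    rw [descPochhammer_coeff_self, momentLimit, h72] at h
    convert! h using 2
    · ring
    · field_simp
  · have h := (tendsto_majBinomMoment_div (Nat.le_succ (2 * r)) le_rfl hi).mul_const
      (((r - 1).factorial : ℝ) * 2 ^ r * 36 ^ r)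
    rw [descPochhammer_coeff_pred, momentLimit, h72, Nat.factorial_succ, hrfac] at h
    convert! h using 2
    · ring
    · push_cast
      field_simp
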